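/- For every real t with 0 < t ≤ 1/8, the function f(t) := (1/t)·ln((1 − 3t)/(1 − 6t)) − 4·ln(4π)·t + 16·t·ln t satisfies f(t) ≥ 0.7. -/

import Mathlib

open Set

/-- A truncated exponential series that dominates `x` yields an upper bound for `log x`. -/
lemma log_le_of_le_sum_range {x q : ℝ} (n : ℕ) (hx : 0 < x) (hq : 0 ≤ q)
    (h : x ≤ ∑ i ∈ Finset.range n, q ^ i / (i.factorial : ℝ)) : Real.log x ≤ q :=
  (Real.log_le_iff_le_exp hx).2 (h.trans (Real.sum_le_exp_of_nonneg hq n))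

/-- The difference between `log ((1 - 3x) / (1 - 6x))` and its quadratic minorant. -/
noncomputable def logQuadGap (x : ℝ) : ℝ :=
  Real.log (1 - 3 * x) - Real.log (1 - 6 * x) - 2447 / 1250 * x - 316390413 / 9086875 * x ^ 2

/-- The quadratic factor in the numerator of the derivative of `logQuadGap`. -/
noncomputable def gapFactor (x : ℝ) : ℝ :=
  (-11390054868 * x ^ 2 + 4479138234 * x - 120451926) / 9086875

lemma gapFactor_mono {x y : ℝ} (hxy : x ≤ y) (hy : y ≤ 1 / 8) : gapFactor x ≤ gapFactor y := by
  unfold gapFactor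
  have := mul_nonneg (sub_nonneg.2 hxy) (by linarith : 0 ≤ 1 / 4 - (x + y))
  linarith

lemma hasDerivAt_logQuadGap {x : ℝ} (hx : x ≤ 1 / 8) :
    HasDerivAt logQuadGap ((x - 67 / 852) * gapFactor x / ((1 - 3 * x) * (1 - 6 * x))) x := by
  have h3 : 1 - 3 * x ≠ 0 := by linarith
  have h6 : 1 - 6 * x ≠ 0 := by linarith
  have d (c : ℝ) : HasDerivAt (fun y : ℝ => 1 - c * y) (-c) x := by
    simpa using ((hasDerivAt_id x).const_mul c).const_sub 1
  have h := ((((d 3).log h3).sub ((d 6).log h6)).sub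
    ((hasDerivAt_id x).const_mul (2447 / 1250))).sub
    ((hasDerivAt_pow 2 x).const_mul (316390413 / 9086875))
  refine h.congr_deriv ?_
  rw [div_sub_div _ _ h3 h6, eq_div_iff (mul_ne_zero h3 h6), sub_mul, sub_mul,
    div_mul_cancel₀ _ (mul_ne_zero h3 h6), gapFactor]
  norm_num
  ring

lemma logQuadGap_mono {x y : ℝ} (hxy : x ≤ y) (hy : y ≤ 1 / 8)
    (h : ∀ z ∈ Icc x y, 0 ≤ (z - 67 / 852) * gapFactor z) : logQuadGap x ≤ logQuadGap y := by
  have hd : ∀ z ∈ Icc x y, HasDerivAt logQuadGap _ z :=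
    fun z hz => hasDerivAt_logQuadGap (hz.2.trans hy)
  refine monotoneOn_of_deriv_nonneg (convex_Icc x y) (HasDerivAt.continuousOn hd)
    (fun z hz => (hd z (interior_subset hz)).differentiableAt.differentiableWithinAt)
    (fun z hz => ?_) (left_mem_Icc.2 hxy) (right_mem_Icc.2 hxy) hxy
  have hz := interior_subset hz
  rw [(hd z hz).deriv]
  have := hz.2
  exact div_nonneg (h z hz) (mul_nonneg (by linarith) (by linarith))

lemma logQuadGap_anti {x y : ℝ} (hxy : x ≤ y) (hy : y ≤ 1 / 8)
    (h : ∀ z ∈ Icc x y, (z - 67 / 852) * gapFactor z ≤ 0) : logQuadGap y ≤ logQuadGap x := by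
  have hd : ∀ z ∈ Icc x y, HasDerivAt logQuadGap _ z :=
    fun z hz => hasDerivAt_logQuadGap (hz.2.trans hy)
  refine antitoneOn_of_deriv_nonpos (convex_Icc x y) (HasDerivAt.continuousOn hd)
    (fun z hz => (hd z (interior_subset hz)).differentiableAt.differentiableWithinAt)
    (fun z hz => ?_) (left_mem_Icc.2 hxy) (right_mem_Icc.2 hxy) hxy
  have hz := interior_subset hz
  rw [(hd z hz).deriv]
  have := hz.2
  exact div_nonpos_of_nonpos_of_nonneg (h z hz) (mul_nonneg (by linarith) (by linarith))

lemma logQuadGap_critical_nonneg : 0 ≤ logQuadGap (67 / 852) := by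
  have h : Real.log (300 / 217) ≤ 0.323886 :=
    log_le_of_le_sum_range 10 (by norm_num) (by norm_num)
      (by norm_num [Finset.sum_range_succ, Nat.factorial])
  have e : Real.log (1 - 3 * (67 / 852)) - Real.log (1 - 6 * (67 / 852))
      = Real.log 2 - Real.log (300 / 217) := by
    rw [← Real.log_div (by norm_num) (by norm_num), ← Real.log_div (by norm_num) (by norm_num)]
    norm_num
  unfold logQuadGap
  rw [e]
  have := Real.log_two_gt_d9
  norm_num at *
  linarith

lemma logQuadGap_nonneg {t : ℝ} (ht0 : 0 ≤ t) (ht1 : t ≤ 1 / 8) : 0 ≤ logQuadGap t := by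
  rcases le_total (67 / 852) t with hr | hr
  · refine logQuadGap_critical_nonneg.trans (logQuadGap_mono hr ht1 fun z hz => ?_)
    have h0 : 0 ≤ gapFactor (67 / 852) := by norm_num [gapFactor]
    exact mul_nonneg (sub_nonneg.2 hz.1) (h0.trans (gapFactor_mono hz.1 (hz.2.trans ht1)))
  rcases le_total (gapFactor t) 0 with hq | hq
  · have h0 : logQuadGap 0 = 0 := by simp [logQuadGap]
    refine h0.symm.le.trans (logQuadGap_mono ht0 ht1 fun z hz => ?_)
    exact mul_nonneg_of_nonpos_of_nonpos (sub_nonpos.2 (hz.2.trans hr))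
      ((gapFactor_mono hz.2 ht1).trans hq)
  · refine logQuadGap_critical_nonneg.trans (logQuadGap_anti hr (by norm_num) fun z hz => ?_)
    exact mul_nonpos_of_nonpos_of_nonneg (sub_nonpos.2 hz.2)
      (hq.trans (gapFactor_mono hz.1 (hz.2.trans (by norm_num))))

lemma log_four_pi_sub_le :
    4 * Real.log (4 * Real.pi) - 16 * Real.log (393 / 5000) - 16 ≤ 316390413 / 9086875 := by
  have hpi := Real.pi_lt_d6
  have hpos := Real.pi_pos
  have h : Real.log (4 * Real.pi / (393 / 5000) ^ 4 / 2 ^ 18) ≤ 0.22794 := by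
    refine log_le_of_le_sum_range 10 (by positivity) (by norm_num) ?_
    norm_num [Finset.sum_range_succ, Nat.factorial] at *
    linarith
  rw [Real.log_div (by positivity) (by positivity), Real.log_div (by positivity) (by positivity),
    Real.log_pow, Real.log_pow] at h
  have := Real.log_two_lt_d9
  norm_num at *
  linarith

theorem f_lower_bound (t : ℝ) (ht0 : 0 < t) (ht1 : t ≤ 1/8) :
    0.7 ≤ (1/t) * Real.log ((1 - 3*t)/(1 - 6*t)) - 4 * Real.log (4 * Real.pi) * t
      + 16 * t * Real.log t := by
  have hgap := logQuadGap_nonneg ht0.le ht1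
  unfold logQuadGap at hgap
  rw [sub_sub, sub_nonneg, ← Real.log_div (by linarith) (by linarith)] at hgap
  have hlog : (2447 / 1250 + 316390413 / 9086875 * t)
      ≤ 1 / t * Real.log ((1 - 3 * t) / (1 - 6 * t)) := by
    rw [one_div_mul_eq_div, le_div_iff₀ ht0]
    linarith
  have htangent : t * Real.log (393 / 5000) + t - 393 / 5000 ≤ t * Real.log t := by
    have h := Real.log_le_sub_one_of_pos (x := 393 / 5000 / t) (by positivity)
    rw [Real.log_div (by norm_num) ht0.ne'] at h
    have h' := mul_le_mul_of_nonneg_left h ht0.le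
    have e : t * (393 / 5000 / t - 1) = 393 / 5000 - t := by field_simp
    linarith
  have hconst := mul_le_mul_of_nonneg_right log_four_pi_sub_le ht0.le
  norm_num at *
  linarith
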